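/- (Generalized Ebeling theorem.) Let G be a finite subgroup of SU(2), with Poincaré series P ∈ ℂ⟦t⟧ of the invariant algebra and McKay matrix B : Matrix ι ι ℂ with distinguished trivial index i₀ as above. Suppose given finite types p, q, matrices D : Matrix p q ℂ, F : Matrix q p ℂ, and a bijection e : ι ≃ p ⊕ q with e i₀ lying in the p-component, such that B i j = (Matrix.fromBlocks 0 (−2D) (−2F) 0) (e i) (e j) for all i, j (a bipartite presentation of the McKay matrix). Let C_a = w₂ * w₁ be the affine Coxeter transformation built from D, F, and let C = w₂° * w₁° be the Coxeter transformation built from the matrices D° (D with the row e i₀ deleted) and F° (F with the column e i₀ deleted). Then in ℂ⟦t⟧: P · det(t² • 1 − C_a) = det(t² • 1 − C); equivalently, P(t) = 𝒳(t²)/𝒳̃(t²), the quotient of the characteristic polynomial of the Coxeter transformation by that of the affine Coxeter transformation, evaluated at t². -/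

import Mathlib

open MvPolynomial CategoryTheory

/-- The algebra endomorphism of `ℂ[x₁,x₂]` induced by a `2 × 2` matrix `u`,
sending the variable `X i` to `∑ j, u j i • X j`. -/
noncomputable def matrixSubst (u : Matrix (Fin 2) (Fin 2) ℂ) :
    MvPolynomial (Fin 2) ℂ →ₐ[ℂ] MvPolynomial (Fin 2) ℂ :=
  aeval fun i => ∑ j, u j i • X j

/-- The degree-`n` homogeneous component of the algebra of invariants of `G`:
homogeneous polynomials of degree `n` fixed by `σ(u)` for all `u ∈ G`. -/
noncomputable def invariantsComponent (G : Subgroup (Matrix.SpecialLinearGroup (Fin 2) ℂ))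
    (n : ℕ) : Submodule ℂ (MvPolynomial (Fin 2) ℂ) :=
  homogeneousSubmodule (Fin 2) ℂ n ⊓
    ⨅ u : G, LinearMap.eqLocus
      (matrixSubst (((u : Matrix.SpecialLinearGroup (Fin 2) ℂ) :
        Matrix (Fin 2) (Fin 2) ℂ))).toLinearMap LinearMap.id

/-- The Poincaré series of the algebra of `G`-invariants of `ℂ[x,y]`: its `n`-th
coefficient is the dimension of the space of degree-`n` invariants. -/
noncomputable def invariantsPoincareSeries
    (G : Subgroup (Matrix.SpecialLinearGroup (Fin 2) ℂ)) : PowerSeries ℂ :=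
  PowerSeries.mk fun n => ((Module.finrank ℂ (invariantsComponent G n) : ℕ) : ℂ)

section Characters

open Representation Matrix
open scoped ComplexOrder

variable {G : Type} [Group G] {V : Type} [AddCommGroup V] [Module ℂ V]
  [FiniteDimensional ℂ V]

/-- Characters are additive along a decomposition into complementary subrepresentations. -/
theorem Representation.character_eq_add_of_isCompl (ρ : Representation ℂ G V)
    {σ τ : Subrepresentation ρ} (h : IsCompl σ.toSubmodule τ.toSubmodule) (g : G) :
    ρ.character g = σ.toRepresentation.character g + τ.toRepresentation.character g := by
  have key : ρ g = (Submodule.prodEquivOfIsCompl _ _ h).conj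
      ((σ.toRepresentation g).prodMap (τ.toRepresentation g)) := by
    refine LinearMap.ext fun x => ?_
    obtain ⟨y, rfl⟩ := (Submodule.prodEquivOfIsCompl _ _ h).surjective x
    simp [LinearEquiv.conj_apply_apply, Subrepresentation.toRepresentation]
  rw [character, key, LinearMap.trace_conj', LinearMap.trace_prodMap']
  rfl

variable [Fintype G]

/-- A finite group of matrices preserves a positive definite Hermitian form. -/
theorem Matrix.exists_posDef_invariant {n : Type} [Fintype n] [DecidableEq n]
    (A : G →* Matrix n n ℂ) :
    ∃ H : Matrix n n ℂ, H.PosDef ∧ ∀ g, (A g)ᴴ * H * A g = H := by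
  classical
  refine ⟨∑ h, (A h)ᴴ * A h, ?_, fun g => ?_⟩
  · rw [← Finset.add_sum_erase _ _ (Finset.mem_univ (1 : G))]
    refine PosDef.add_posSemidef (by simpa using PosDef.one) ?_
    exact posSemidef_sum _ fun h _ => posSemidef_conjTranspose_mul_self _
  · rw [Finset.mul_sum, Finset.sum_mul]
    refine Fintype.sum_equiv (Equiv.mulRight g) _ _ fun h => ?_
    simp [Matrix.mul_assoc]

/-- Matrices in a finite group satisfy `conj (tr a) = tr a⁻¹`. -/
theorem Matrix.star_trace_eq_trace_inv {n : Type} [Fintype n] [DecidableEq n]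
    (A : G →* Matrix n n ℂ) (g : G) : star (A g).trace = (A g⁻¹).trace := by
  obtain ⟨H, hH, hinv⟩ := exists_posDef_invariant A
  have hu : IsUnit H.det := (isUnit_iff_isUnit_det H).1 hH.isUnit
  have key : (A g)ᴴ = H * A g⁻¹ * H⁻¹ := by
    have h1 : (A g)ᴴ * H = H * A g⁻¹ := by
      calc (A g)ᴴ * H = (A g)ᴴ * H * (A g * A g⁻¹) := by simp [← map_mul]
        _ = H * A g⁻¹ := by rw [← Matrix.mul_assoc, hinv]
    rw [← h1, Matrix.mul_assoc, mul_nonsing_inv _ hu, Matrix.mul_one]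
  rw [← trace_conjTranspose, key, trace_mul_comm, ← Matrix.mul_assoc, nonsing_inv_mul _ hu,
    Matrix.one_mul]

/-- Over a finite group, the conjugate of a complex character is its value at the inverse. -/
theorem Representation.conj_character (ρ : Representation ℂ G V) (g : G) :
    starRingEnd ℂ (ρ.character g) = ρ.character g⁻¹ := by
  let b := Module.finBasis ℂ V
  have := star_trace_eq_trace_inv
    ((MonoidHomClass.toMonoidHom (LinearMap.toMatrixAlgEquiv b)).comp ρ) g
  simpa [character, LinearMap.trace_eq_matrix_trace ℂ b, LinearMap.toMatrixAlgEquiv] using this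

theorem Representation.simple_fdRep_of_isIrreducible (ρ : Representation ℂ G V)
    [IsIrreducible ρ] : Simple (FDRep.of ρ) := by
  classical
  have : Invertible (Nat.card G : ℂ) := invertibleOfNonzero (by simp)
  rw [FDRep.simple_iff_char_is_norm_one]
  have := char_orthonormal ρ ρ
  rw [if_pos ⟨Representation.Equiv.refl ρ⟩, inv_mul_eq_one₀ (by simp)] at this
  exact this.symm

/-- Every character of a finite group is a combination of irreducible ones. -/
theorem Representation.exists_character_eq_sum {ι : Type} [Fintype ι] [DecidableEq ι]
    (S : ι → FDRep ℂ G)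
    (hall : ∀ V : FDRep ℂ G, Simple V → ∃ i, Nonempty (V ≅ S i)) (ρ : Representation ℂ G V) :
    ∃ m : ι → ℂ, ∀ g, ρ.character g = ∑ i, m i * (S i).character g := by
  induction hn : Module.finrank ℂ V using Nat.strong_induction_on generalizing V with
  | _ n ih =>
  by_cases hV : Subsingleton V
  · exact ⟨0, fun g => by simp [character, Subsingleton.elim (ρ g) 0]⟩
  rw [not_subsingleton_iff_nontrivial] at hV
  by_cases hirr : IsIrreducible ρ
  · obtain ⟨i, ⟨φ⟩⟩ := hall _ (simple_fdRep_of_isIrreducible ρ)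
    exact ⟨Pi.single i 1, fun g => by
      rw [show ρ.character g = (FDRep.of ρ).character g from rfl, FDRep.char_iso φ]
      simp [Pi.single_apply]⟩
  · have : Nontrivial (Subrepresentation ρ) := by
      refine ⟨⊥, ⊤, fun h => ?_⟩
      exact bot_ne_top (α := Submodule ℂ V) (congrArg Subrepresentation.toSubmodule h)
    have : ∃ σ : Subrepresentation ρ, σ ≠ ⊥ ∧ σ ≠ ⊤ := by
      by_contra! h
      exact hirr ⟨fun σ => or_iff_not_imp_left.2 (h σ)⟩
    obtain ⟨σ, hσ, hσ'⟩ := this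
    have : NeZero (Nat.card G : ℂ) := ⟨by simp⟩
    have : IsSemisimpleRepresentation ρ := inferInstance
    obtain ⟨τ, hστ⟩ := exists_isCompl σ
    have hc : IsCompl σ.toSubmodule τ.toSubmodule := by
      refine IsCompl.of_eq ?_ ?_
      · exact congrArg Subrepresentation.toSubmodule hστ.inf_eq_bot
      · exact congrArg Subrepresentation.toSubmodule hστ.sup_eq_top
    have hσt : σ.toSubmodule ≠ ⊤ := fun h => hσ' (Subrepresentation.toSubmodule_injective h)
    have hτt : τ.toSubmodule ≠ ⊤ := fun h => hσ <| Subrepresentation.toSubmodule_injective <| by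
      have := hc.inf_eq_bot
      rwa [h, inf_top_eq] at this
    obtain ⟨m, hm⟩ := ih _ (hn ▸ Submodule.finrank_lt hσt) σ.toRepresentation rfl
    obtain ⟨m', hm'⟩ := ih _ (hn ▸ Submodule.finrank_lt hτt) τ.toRepresentation rfl
    exact ⟨m + m', fun g => by
      rw [character_eq_add_of_isCompl ρ hc, hm, hm', ← Finset.sum_add_distrib]
      simp [add_mul]⟩

variable {ι : Type} [DecidableEq ι] {S : ι → FDRep ℂ G}

/-- Orthonormality of a family of pairwise non-isomorphic irreducible characters. -/
theorem FDRep.sum_character_mul_conj (hsimple : ∀ i, Simple (S i))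
    (hdist : ∀ i j, i ≠ j → ¬ Nonempty (S i ≅ S j)) (i j : ι) :
    ∑ g, (S i).character g * starRingEnd ℂ ((S j).character g)
      = if i = j then (Fintype.card G : ℂ) else 0 := by
  classical
  have : Invertible (Nat.card G : ℂ) := invertibleOfNonzero (by simp)
  have := hsimple i
  have := hsimple j
  have h := FDRep.char_orthonormal (S i) (S j)
  have hiff : Nonempty (S i ≅ S j) ↔ i = j :=
    ⟨fun h => by_contra fun hij => hdist i j hij h, fun h => h ▸ ⟨Iso.refl _⟩⟩
  have hconj (g : G) : starRingEnd ℂ ((S j).character g) = (S j).character g⁻¹ :=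
    Representation.conj_character (S j).ρ g
  simp only [hconj]
  rw [inv_mul_eq_iff_eq_mul₀ (by simp)] at h
  rw [h]
  simp [hiff]

/-- Expansion of a character in terms of irreducible characters. -/
theorem Representation.character_eq_sum [Fintype ι] (hsimple : ∀ i, Simple (S i))
    (hdist : ∀ i j, i ≠ j → ¬ Nonempty (S i ≅ S j))
    (hall : ∀ V : FDRep ℂ G, Simple V → ∃ i, Nonempty (V ≅ S i)) (ρ : Representation ℂ G V)
    (g : G) :
    ρ.character g = ∑ i, (1 / (Fintype.card G : ℂ) *
      ∑ h, ρ.character h * starRingEnd ℂ ((S i).character h)) * (S i).character g := by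
  obtain ⟨m, hm⟩ := exists_character_eq_sum S hall ρ
  rw [hm]
  refine Finset.sum_congr rfl fun i _ => ?_
  congr 1
  have : ∑ h, ρ.character h * starRingEnd ℂ ((S i).character h) = m i * Fintype.card G := by
    simp_rw [hm, Finset.sum_mul]
    rw [Finset.sum_comm]
    simp_rw [mul_assoc, ← Finset.mul_sum, FDRep.sum_character_mul_conj hsimple hdist]
    simp
  rw [this]
  field_simp

end Characters

section Determinants

open Matrix

variable {R : Type*} [CommRing R] {p q : Type} [Fintype p] [Fintype q] [DecidableEq p]
  [DecidableEq q]

/-- The characteristic polynomial at `t ^ 2` of the product of two block reflections. -/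
theorem Matrix.det_sq_sub_coxeter [IsDomain R] {t : R} (ht : t ≠ 0)
    (A : Matrix p q R) (A' : Matrix q p R) :
    (t ^ 2 • (1 : Matrix (p ⊕ q) (p ⊕ q) R) -
        fromBlocks (-1) A 0 1 * fromBlocks 1 0 A' (-1)).det
      = ((1 + t ^ 2) • (1 : Matrix (p ⊕ q) (p ⊕ q) R) - t • fromBlocks 0 A A' 0).det := by
  set N := t ^ 2 • (1 : Matrix (p ⊕ q) (p ⊕ q) R) -
    fromBlocks (-1) A 0 1 * fromBlocks 1 0 A' (-1)
  set M := (1 + t ^ 2) • (1 : Matrix (p ⊕ q) (p ⊕ q) R) - t • fromBlocks 0 A A' 0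
  let E : Matrix (p ⊕ q) (p ⊕ q) R := fromBlocks (diagonal fun _ => -t) 0 0 1
  let L : Matrix (p ⊕ q) (p ⊕ q) R := fromBlocks 1 0 A' 1
  have hE : E.det ≠ 0 := by
    simp [E, ht]
  have hL : L.det = 1 := by simp [L]
  have key : E * N * L = M * E := by
    simp only [E, N, M, L, ← fromBlocks_one, fromBlocks_smul, fromBlocks_multiply, sub_eq_add_neg,
      fromBlocks_neg, fromBlocks_add, ← smul_one_eq_diagonal]
    congr 1 <;> simp [Matrix.add_mul, smul_smul] <;> module
  apply mul_left_cancel₀ hE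
  rw [mul_comm E.det M.det, ← det_mul, ← det_mul, ← key, det_mul (E * N), hL, mul_one]

/-- Expansion of the determinant of a matrix one of whose rows is a unit vector. -/
theorem Matrix.det_updateRow_single_inl (M : Matrix (p ⊕ q) (p ⊕ q) R) (a : p) :
    (M.updateRow (Sum.inl a) (Pi.single (Sum.inl a) 1)).det
      = (M.submatrix (Sum.map ((↑) : {x // x ≠ a} → p) id) (Sum.map (↑) id)).det := by
  rw [twoBlockTriangular_det' _ (· = Sum.inl a)]
  · have det_eq_one {n : Type} {_ : Fintype n} {_ : DecidableEq n} {N : Matrix n n R}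
        (h : ∀ i j, N i j = if i = j then 1 else 0) : N.det = 1 := by
      rw [show N = 1 from Matrix.ext fun i j => by rw [h, one_apply], det_one]
    rw [det_eq_one, one_mul]
    swap
    · rintro ⟨x, rfl⟩ ⟨y, rfl⟩
      simp [toSquareBlockProp_def]
    let f : {x // x ≠ a} ⊕ q ≃ {x : p ⊕ q // ¬ x = Sum.inl a} :=
      Equiv.ofBijective (fun x => ⟨Sum.map (↑) id x, by
          rcases x with x | x
          · simpa using x.2
          · simp⟩)
        ⟨by rintro (⟨x, hx⟩ | x) (⟨y, hy⟩ | y) <;> simp,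
          by
            rintro ⟨x | x, hx⟩
            · exact ⟨Sum.inl ⟨x, by simpa using hx⟩, rfl⟩
            · exact ⟨Sum.inr x, rfl⟩⟩
    rw [← det_submatrix_equiv_self f]
    congr 1
    ext x y
    simp only [submatrix_apply, toSquareBlockProp_def, of_apply]
    rw [updateRow_ne (f x).2]
    rfl
  · rintro i rfl j hj
    simp [hj]

/-- Cramer's rule for a row vector mapped to a unit vector. -/
theorem Matrix.mul_det_of_vecMul_eq_single {n : Type} [Fintype n] [DecidableEq n]
    {M : Matrix n n R} {v : n → R} {i : n} (h : v ᵥ* M = Pi.single i 1) :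
    v i * M.det = (M.updateRow i (Pi.single i 1)).det := by
  have := congrFun (congrArg (· ᵥ* M.adjugate) h) i
  simp only [vecMul_vecMul, mul_adjugate, single_one_vecMul, row_apply, adjugate_apply] at this
  rw [← this, vecMul_smul, vecMul_one, Pi.smul_apply, smul_eq_mul, mul_comm]

end Determinants

section Molien

open Matrix

theorem matrixSubst_one : matrixSubst 1 = AlgHom.id ℂ _ := by
  refine MvPolynomial.algHom_ext fun i => ?_
  simp [matrixSubst, one_apply]

theorem matrixSubst_mul (u v : Matrix (Fin 2) (Fin 2) ℂ) :
    matrixSubst (u * v) = (matrixSubst u).comp (matrixSubst v) := by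
  refine MvPolynomial.algHom_ext fun i => ?_
  simp only [matrixSubst, AlgHom.comp_apply, aeval_X, map_sum, map_smul, mul_apply,
    Finset.sum_smul, Finset.smul_sum, smul_smul]
  rw [Finset.sum_comm]
  simp_rw [mul_comm]

theorem matrixSubst_mem_homogeneousSubmodule (u : Matrix (Fin 2) (Fin 2) ℂ) {n : ℕ}
    {f : MvPolynomial (Fin 2) ℂ} (hf : f ∈ homogeneousSubmodule (Fin 2) ℂ n) :
    matrixSubst u f ∈ homogeneousSubmodule (Fin 2) ℂ n := by
  rw [mem_homogeneousSubmodule] at hf ⊢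
  rw [← one_mul n]
  refine hf.aeval _ fun i => ?_
  exact IsHomogeneous.sum _ _ _ fun j _ => by
    rw [smul_eq_C_mul]; exact (isHomogeneous_X _ _).C_mul _

/-- The action of `2 × 2` matrices on binary forms of degree `n`. -/
noncomputable def binaryForms (n : ℕ) :
    Matrix (Fin 2) (Fin 2) ℂ →* Module.End ℂ (homogeneousSubmodule (Fin 2) ℂ n) where
  toFun u := (matrixSubst u).toLinearMap.restrict fun _ => matrixSubst_mem_homogeneousSubmodule u
  map_one' := by ext; simp [matrixSubst_one]
  map_mul' u v := LinearMap.ext fun f => Subtype.ext <| by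
    simp only [matrixSubst_mul]; rfl

theorem coe_binaryForms_apply (n : ℕ) (u : Matrix (Fin 2) (Fin 2) ℂ)
    (f : homogeneousSubmodule (Fin 2) ℂ n) :
    (binaryForms n u f : MvPolynomial (Fin 2) ℂ) = matrixSubst u f :=
  rfl

instance (n : ℕ) : FiniteDimensional ℂ (homogeneousSubmodule (Fin 2) ℂ n) :=
  Module.Finite.of_fg (homogeneousSubmodule_fg _ _ n)

/-- The basis of the space of binary forms of degree `n` consisting of monomials. -/
noncomputable def binaryFormsBasis (n : ℕ) :
    Module.Basis (Finset.HasAntidiagonal.antidiagonal n) ℂ (homogeneousSubmodule (Fin 2) ℂ n) :=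
  ((basisRestrictSupport ℂ {d : Fin 2 →₀ ℕ | d.degree = n}).map
    (LinearEquiv.ofEq _ _ (homogeneousSubmodule_eq_finsupp_supported (Fin 2) ℂ n).symm)).reindex
  { toFun d := ⟨(d.1 0, d.1 1), by simpa [Finsupp.degree_eq_sum] using d.2⟩
    invFun k := ⟨Finsupp.single 0 k.1.1 + Finsupp.single 1 k.1.2, by
      simpa [Finsupp.degree_eq_sum, -Subtype.coe_prop] using
        Finset.HasAntidiagonal.mem_antidiagonal.1 k.2⟩
    left_inv d := by
      ext i
      fin_cases i <;> simp
    right_inv k := by simp }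

theorem binaryFormsBasis_repr (n : ℕ) (f : homogeneousSubmodule (Fin 2) ℂ n)
    (k : Finset.HasAntidiagonal.antidiagonal n) :
    (binaryFormsBasis n).repr f k
      = coeff (Finsupp.single 0 k.1.1 + Finsupp.single 1 k.1.2) (f : MvPolynomial (Fin 2) ℂ) :=
  rfl

theorem coe_binaryFormsBasis (n : ℕ) (k : Finset.HasAntidiagonal.antidiagonal n) :
    (binaryFormsBasis n k : MvPolynomial (Fin 2) ℂ) = X 0 ^ k.1.1 * X 1 ^ k.1.2 := by
  have h : (X 0 ^ k.1.1 * X 1 ^ k.1.2 : MvPolynomial (Fin 2) ℂ)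
      = monomial (Finsupp.single 0 k.1.1 + Finsupp.single 1 k.1.2) 1 := by
    rw [X_pow_eq_monomial, X_pow_eq_monomial, monomial_mul, one_mul]
  have hmem : (X 0 ^ k.1.1 * X 1 ^ k.1.2 : MvPolynomial (Fin 2) ℂ) ∈
      homogeneousSubmodule (Fin 2) ℂ n := by
    have := (isHomogeneous_X_pow (R := ℂ) (0 : Fin 2) k.1.1).mul
      (isHomogeneous_X_pow (R := ℂ) (1 : Fin 2) k.1.2)
    rwa [Finset.HasAntidiagonal.mem_antidiagonal.1 k.2] at this
  refine congrArg Subtype.val (a₂ := ⟨_, hmem⟩) ?_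
  apply (binaryFormsBasis n).repr.injective
  ext l
  rw [Module.Basis.repr_self, binaryFormsBasis_repr, Finsupp.single_apply]
  change _ = coeff _ (X 0 ^ k.1.1 * X 1 ^ k.1.2)
  rw [h, coeff_monomial]
  refine if_congr ⟨fun hkl => by rw [hkl], fun hkl => ?_⟩ rfl rfl
  refine Subtype.ext (Prod.ext ?_ ?_)
  · simpa using DFunLike.congr_fun hkl 0
  · simpa using DFunLike.congr_fun hkl 1

theorem coeff_pow_mul_add_pow (x y z : ℂ) (a b : ℕ) :
    coeff (Finsupp.single 0 a + Finsupp.single 1 b)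
      ((x • X 0) ^ a * (y • X 0 + z • X 1) ^ b : MvPolynomial (Fin 2) ℂ) = x ^ a * z ^ b := by
  obtain ⟨w, hw⟩ : (X 0 : MvPolynomial (Fin 2) ℂ) ∣ (y • X 0 + z • X 1) ^ b - (z • X 1) ^ b :=
    dvd_trans ⟨C y, by rw [smul_eq_C_mul, smul_eq_C_mul]; ring⟩ (sub_dvd_pow_sub_pow _ _ b)
  have hmon : monomial (Finsupp.single 0 a + Finsupp.single 1 b) (x ^ a * z ^ b)
      = (C (x ^ a) * X 0 ^ a * (C (z ^ b) * X 1 ^ b) : MvPolynomial (Fin 2) ℂ) := by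
    rw [C_mul_X_pow_eq_monomial, C_mul_X_pow_eq_monomial, monomial_mul]
  have hsplit : ((x • X 0) ^ a * (X 0 * w + (z • X 1) ^ b) : MvPolynomial (Fin 2) ℂ)
      = monomial (Finsupp.single 0 (a + 1)) 1 * (C (x ^ a) * w)
        + monomial (Finsupp.single 0 a + Finsupp.single 1 b) (x ^ a * z ^ b) := by
    rw [hmon, ← X_pow_eq_monomial, smul_eq_C_mul, smul_eq_C_mul, mul_pow, mul_pow, C_pow, C_pow]
    ring
  rw [sub_eq_iff_eq_add.1 hw, hsplit, coeff_add, coeff_monomial_mul', coeff_monomial, if_pos rfl,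
    if_neg, zero_add]
  intro hle
  simpa using hle 0

theorem trace_binaryForms_of_upper (n : ℕ) {u : Matrix (Fin 2) (Fin 2) ℂ} (hu : u 1 0 = 0) :
    LinearMap.trace ℂ _ (binaryForms n u)
      = ∑ k ∈ Finset.HasAntidiagonal.antidiagonal n, u 0 0 ^ k.1 * u 1 1 ^ k.2 := by
  rw [LinearMap.trace_eq_matrix_trace ℂ (binaryFormsBasis n), trace,
    ← Finset.sum_coe_sort (Finset.HasAntidiagonal.antidiagonal n)]
  refine Finset.sum_congr rfl fun k _ => ?_
  rw [diag_apply, LinearMap.toMatrix_apply, binaryFormsBasis_repr, coe_binaryForms_apply,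
    coe_binaryFormsBasis, map_mul, map_pow, map_pow, matrixSubst, aeval_X, aeval_X,
    Fin.sum_univ_two, Fin.sum_univ_two, hu, zero_smul, add_zero, coeff_pow_mul_add_pow]

/-- Every complex `2 × 2` matrix is conjugate to an upper triangular one. -/
theorem exists_conj_upper (u : Matrix (Fin 2) (Fin 2) ℂ) :
    ∃ P P' : Matrix (Fin 2) (Fin 2) ℂ, P * P' = 1 ∧ P' * P = 1 ∧ (P' * u * P) 1 0 = 0 := by
  obtain ⟨μ, hμ⟩ := Module.End.exists_eigenvalue (toLin' u)
  obtain ⟨v, hv⟩ := hμ.exists_hasEigenvector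
  have h := hv.apply_eq_smul
  rw [toLin'_apply] at h
  let P : Matrix (Fin 2) (Fin 2) ℂ := !![v 0, -star (v 1); v 1, star (v 0)]
  have hP : IsUnit P.det := by
    have hdet : P.det = ((‖v 0‖ ^ 2 + ‖v 1‖ ^ 2 : ℝ) : ℂ) := by
      simp [P, det_fin_two, Complex.mul_conj', Complex.conj_mul']
    rw [hdet, isUnit_iff_ne_zero, Complex.ofReal_ne_zero]
    intro hzero
    refine hv.2 (funext fun i => ?_)
    fin_cases i <;> simp <;> rw [← norm_eq_zero] <;>
      nlinarith [norm_nonneg (v 0), norm_nonneg (v 1)]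
  refine ⟨P, P⁻¹, mul_nonsing_inv _ hP, nonsing_inv_mul _ hP, ?_⟩
  have hPv : P *ᵥ Pi.single 0 1 = v := by
    ext i
    fin_cases i <;> simp [P]
  have : (P⁻¹ * u * P) *ᵥ Pi.single 0 1 = μ • Pi.single 0 1 := by
    rw [← mulVec_mulVec, hPv, ← mulVec_mulVec, h, mulVec_smul]
    nth_rw 1 [← hPv]
    rw [mulVec_mulVec, nonsing_inv_mul _ hP, one_mulVec]
  simpa using congrFun this 1

/-- The generating series of the traces of `u` on binary forms. -/
noncomputable def binaryFormsTraceSeries (u : Matrix (Fin 2) (Fin 2) ℂ) : PowerSeries ℂ :=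
  PowerSeries.mk fun n => LinearMap.trace ℂ _ (binaryForms n u)

theorem binaryFormsTraceSeries_mul {u : Matrix (Fin 2) (Fin 2) ℂ} (hu : u.det = 1) :
    binaryFormsTraceSeries u * (1 + PowerSeries.X ^ 2 - PowerSeries.C u.trace * PowerSeries.X)
      = 1 := by
  obtain ⟨P, P', hPP', hP'P, hT⟩ := exists_conj_upper u
  set T := P' * u * P with hTdef
  have hconj : u = P * T * P' := by
    rw [hTdef, ← Matrix.mul_assoc, ← Matrix.mul_assoc, hPP', Matrix.one_mul, Matrix.mul_assoc, hPP',
      Matrix.mul_one]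
  have htr : u.trace = T 0 0 + T 1 1 := by
    rw [hconj, trace_mul_comm, ← Matrix.mul_assoc, hP'P, Matrix.one_mul, trace_fin_two]
  have hdet : T 0 0 * T 1 1 = 1 := by
    have : T.det = 1 := by
      rw [hTdef, det_mul, det_mul, hu, mul_one, ← det_mul, hP'P, det_one]
    simpa [det_fin_two, hT] using this
  have hser : binaryFormsTraceSeries u
      = (PowerSeries.mk fun n => T 0 0 ^ n) * PowerSeries.mk fun n => T 1 1 ^ n := by
    ext n
    rw [PowerSeries.coeff_mul]
    simp only [binaryFormsTraceSeries, PowerSeries.coeff_mk]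
    rw [← trace_binaryForms_of_upper n hT, hconj, map_mul, LinearMap.trace_mul_comm, ← map_mul,
      ← Matrix.mul_assoc, hP'P, Matrix.one_mul]
  have hgeom (a : ℂ) :
      (PowerSeries.mk fun n => a ^ n) * (1 - PowerSeries.C a * PowerSeries.X) = 1 := by
    ext n
    rw [mul_sub, mul_one, ← mul_assoc, mul_right_comm]
    cases n <;> simp [pow_succ, PowerSeries.coeff_succ_mul_X]
  have hfac : (1 + PowerSeries.X ^ 2 - PowerSeries.C u.trace * PowerSeries.X : PowerSeries ℂ)
      = (1 - PowerSeries.C (T 0 0) * PowerSeries.X) *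
        (1 - PowerSeries.C (T 1 1) * PowerSeries.X) := by
    have := congrArg (PowerSeries.C (R := ℂ)) hdet
    rw [map_mul, map_one] at this
    rw [htr, map_add]
    linear_combination -PowerSeries.X ^ 2 * this
  rw [hser, hfac, mul_mul_mul_comm, hgeom, hgeom, one_mul]

/-- Molien's formula, coefficientwise. -/
theorem finrank_invariantsComponent (G : Subgroup (Matrix.SpecialLinearGroup (Fin 2) ℂ))
    [Fintype G] (n : ℕ) :
    (Module.finrank ℂ (invariantsComponent G n) : ℂ) = 1 / (Fintype.card G : ℂ) *
      ∑ g : G, LinearMap.trace ℂ _ (binaryForms n (g : SpecialLinearGroup (Fin 2) ℂ)) := by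
  let ρ : Representation ℂ G (homogeneousSubmodule (Fin 2) ℂ n) :=
    (binaryForms n).comp (SpecialLinearGroup.coeMonoidHom.comp G.subtype)
  have : Invertible (Nat.card G : ℂ) := invertibleOfNonzero (by simp)
  have h := ρ.card_inv_mul_sum_char_eq_finrank
  have hinv : invariantsComponent G n
      = ρ.invariants.map (homogeneousSubmodule (Fin 2) ℂ n).subtype := by
    ext f
    simp only [invariantsComponent, Submodule.mem_inf, Submodule.mem_iInf, Submodule.mem_map,
      Representation.mem_invariants]
    constructor
    · exact fun ⟨hf, h⟩ => ⟨⟨f, hf⟩, fun g => Subtype.ext (h g), rfl⟩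
    · rintro ⟨f, h, rfl⟩
      exact ⟨f.2, fun g => congrArg Subtype.val (h g)⟩
  rw [hinv, Submodule.finrank_map_subtype_eq, ← h]
  simp [Representation.character, ρ]

end Molien

section McKay

open Matrix

variable (G : Subgroup (SpecialLinearGroup (Fin 2) ℂ)) [Fintype G]

/-- The matrix `(1 + t ^ 2) - t K` of power series. -/
noncomputable def chebyshevMatrix {n : Type} [DecidableEq n] (K : Matrix n n ℂ) :
    Matrix n n (PowerSeries ℂ) :=
  (1 + PowerSeries.X ^ 2 : PowerSeries ℂ) • 1 - (PowerSeries.X : PowerSeries ℂ) •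
    K.map PowerSeries.C

/-- The characteristic polynomial of a Coxeter transformation at `t ^ 2`. -/
theorem det_coxeter_eq_det_chebyshevMatrix {p q : Type} [Fintype p] [Fintype q] [DecidableEq p]
    [DecidableEq q] (A : Matrix p q ℂ) (A' : Matrix q p ℂ) :
    (((Polynomial.X : Polynomial ℂ) ^ 2 • (1 : Matrix (p ⊕ q) (p ⊕ q) (Polynomial ℂ)) -
        (fromBlocks (-1) A 0 1 * fromBlocks 1 0 A' (-1)).map Polynomial.C).det : PowerSeries ℂ)
      = (chebyshevMatrix (fromBlocks 0 A A' 0)).det := by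
  have h := det_sq_sub_coxeter (PowerSeries.X_ne_zero (R := ℂ)) (A.map PowerSeries.C)
    (A'.map PowerSeries.C)
  have hK : chebyshevMatrix (fromBlocks 0 A A' 0)
      = (1 + PowerSeries.X ^ 2 : PowerSeries ℂ) • (1 : Matrix (p ⊕ q) (p ⊕ q) (PowerSeries ℂ)) -
        (PowerSeries.X : PowerSeries ℂ) •
          fromBlocks 0 (A.map PowerSeries.C) (A'.map PowerSeries.C) 0 := by
    simp [chebyshevMatrix, fromBlocks_map]
  have hneg {n : Type} [DecidableEq n] :
      (-1 : Matrix n n ℂ).map (PowerSeries.C (R := ℂ)) = -1 := by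
    ext1 i j
    simp [one_apply, apply_ite]
  have hW : fromBlocks (-1) (A.map PowerSeries.C) 0 1 * fromBlocks 1 0 (A'.map PowerSeries.C) (-1)
      = (fromBlocks (-1) A 0 1 * fromBlocks 1 0 A' (-1)).map PowerSeries.C := by
    simp [Matrix.map_mul, fromBlocks_map, hneg]
  rw [hK, ← h, hW]
  refine (RingHom.map_det (Polynomial.coeToPowerSeries.ringHom (R := ℂ)) _).trans (congrArg det ?_)
  generalize fromBlocks (-1) A 0 1 * fromBlocks 1 0 A' (-1) = W
  ext1 i j
  simp [one_apply, apply_ite]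

/-- The generating series of the averages over `G` of a function against the traces on binary
forms. For an irreducible character of `G` it counts multiplicities in binary forms. -/
noncomputable def averageTraceSeries (χ : G → ℂ) : PowerSeries ℂ :=
  (1 / (Fintype.card G : ℂ)) •
    ∑ g : G, χ g • binaryFormsTraceSeries (g : SpecialLinearGroup (Fin 2) ℂ)

/-- Molien's formula. -/
theorem averageTraceSeries_one : averageTraceSeries G 1 = invariantsPoincareSeries G := by
  ext n
  simp [averageTraceSeries, invariantsPoincareSeries, finrank_invariantsComponent,
    binaryFormsTraceSeries]

theorem averageTraceSeries_mul (χ : G → ℂ) :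
    (1 + PowerSeries.X ^ 2) * averageTraceSeries G χ - PowerSeries.X * averageTraceSeries G
        (fun g => ((g : SpecialLinearGroup (Fin 2) ℂ) : Matrix (Fin 2) (Fin 2) ℂ).trace * χ g)
      = PowerSeries.C (1 / (Fintype.card G : ℂ) * ∑ g, χ g) := by
  rw [averageTraceSeries, averageTraceSeries, mul_smul_comm, mul_smul_comm, ← smul_sub, map_mul,
    map_sum, ← PowerSeries.smul_eq_C_mul, Finset.mul_sum, Finset.mul_sum, ← Finset.sum_sub_distrib]
  congr 1
  refine Finset.sum_congr rfl fun g _ => ?_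
  rw [PowerSeries.smul_eq_C_mul, PowerSeries.smul_eq_C_mul, map_mul]
  linear_combination PowerSeries.C (χ g) *
    binaryFormsTraceSeries_mul (g : SpecialLinearGroup (Fin 2) ℂ).2

variable {G} {ι : Type} [Fintype ι] [DecidableEq ι] {S : ι → FDRep ℂ G}

/-- Multiplication by the character of the standard representation, via the McKay matrix. -/
theorem trace_mul_character_eq_sum (hsimple : ∀ i, Simple (S i))
    (hdist : ∀ i j, i ≠ j → ¬ Nonempty (S i ≅ S j))
    (hall : ∀ V : FDRep ℂ G, Simple V → ∃ i, Nonempty (V ≅ S i)) {B : Matrix ι ι ℂ}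
    (hB : ∀ i j, B i j = (1 / (Fintype.card G : ℂ)) *
      ∑ g : G, (trace ((g : SpecialLinearGroup (Fin 2) ℂ) : Matrix (Fin 2) (Fin 2) ℂ) *
        (S j).character g) * (starRingEnd ℂ) ((S i).character g)) (j : ι) (g : G) :
    ((g : SpecialLinearGroup (Fin 2) ℂ) : Matrix (Fin 2) (Fin 2) ℂ).trace * (S j).character g
      = ∑ i, B i j * (S i).character g := by
  let std : Representation ℂ G (Fin 2 → ℂ) :=
    (toLinAlgEquiv' : Matrix (Fin 2) (Fin 2) ℂ ≃ₐ[ℂ] _).toMonoidHom.comp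
      (SpecialLinearGroup.coeMonoidHom.comp G.subtype)
  have hchar (h : G) : (std.tprod (S j).ρ).character h
      = ((h : SpecialLinearGroup (Fin 2) ℂ) : Matrix (Fin 2) (Fin 2) ℂ).trace
        * (S j).character h := by
    rw [Representation.char_tensor, Pi.mul_apply]
    congr 1
    exact trace_toLin'_eq _
  simp_rw [hB, ← hchar]
  exact Representation.character_eq_sum hsimple hdist hall (std.tprod (S j).ρ) g

/-- The Chebyshev matrix of the McKay matrix sends the vector of multiplicity series to the unit
vector at the trivial representation. -/
theorem averageTraceSeries_vecMul (hsimple : ∀ i, Simple (S i))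
    (hdist : ∀ i j, i ≠ j → ¬ Nonempty (S i ≅ S j))
    (hall : ∀ V : FDRep ℂ G, Simple V → ∃ i, Nonempty (V ≅ S i)) {i₀ : ι}
    (htriv : ∀ g : G, (S i₀).character g = 1) {B : Matrix ι ι ℂ}
    (hB : ∀ i j, B i j = (1 / (Fintype.card G : ℂ)) *
      ∑ g : G, (trace ((g : SpecialLinearGroup (Fin 2) ℂ) : Matrix (Fin 2) (Fin 2) ℂ) *
        (S j).character g) * (starRingEnd ℂ) ((S i).character g)) :
    (fun i => averageTraceSeries G (S i).character) ᵥ* chebyshevMatrix B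
      = Pi.single i₀ 1 := by
  ext1 j
  have hsum : ((fun i => averageTraceSeries G (S i).character) ᵥ* B.map PowerSeries.C) j
      = averageTraceSeries G fun g =>
        ((g : SpecialLinearGroup (Fin 2) ℂ) : Matrix (Fin 2) (Fin 2) ℂ).trace
          * (S j).character g := by
    simp_rw [trace_mul_character_eq_sum hsimple hdist hall hB j]
    simp only [vecMul, dotProduct, averageTraceSeries, map_apply, smul_mul_assoc, ← Finset.smul_sum,
      Finset.sum_mul, Finset.sum_smul]
    rw [Finset.sum_comm]
    simp only [PowerSeries.smul_eq_C_mul, map_mul]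
    congr! 3
    ring
  have horth : 1 / (Fintype.card G : ℂ) * ∑ g, (S j).character g = if j = i₀ then 1 else 0 := by
    have h := FDRep.sum_character_mul_conj hsimple hdist j i₀
    simp only [htriv, map_one, mul_one] at h
    rw [h]
    split_ifs <;> simp
  rw [chebyshevMatrix, vecMul_sub, vecMul_smul, vecMul_smul, vecMul_one, Pi.sub_apply,
    Pi.smul_apply, Pi.smul_apply, hsum]
  exact (averageTraceSeries_mul G _).trans (by rw [horth, Pi.single_apply]; split_ifs <;> simp)

/-- The Poincaré series as a quotient of determinants. -/
theorem invariantsPoincareSeries_mul_det (hsimple : ∀ i, Simple (S i))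
    (hdist : ∀ i j, i ≠ j → ¬ Nonempty (S i ≅ S j))
    (hall : ∀ V : FDRep ℂ G, Simple V → ∃ i, Nonempty (V ≅ S i)) {i₀ : ι}
    (htriv : ∀ g : G, (S i₀).character g = 1) {B : Matrix ι ι ℂ}
    (hB : ∀ i j, B i j = (1 / (Fintype.card G : ℂ)) *
      ∑ g : G, (trace ((g : SpecialLinearGroup (Fin 2) ℂ) : Matrix (Fin 2) (Fin 2) ℂ) *
        (S j).character g) * (starRingEnd ℂ) ((S i).character g))
    {p q : Type} [Fintype p] [Fintype q] [DecidableEq p] [DecidableEq q] (e : ι ≃ p ⊕ q) {a₀ : p}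
    (he : e i₀ = Sum.inl a₀) {K : Matrix (p ⊕ q) (p ⊕ q) ℂ} (hK : ∀ i j, B i j = K (e i) (e j)) :
    invariantsPoincareSeries G * (chebyshevMatrix K).det
      = (chebyshevMatrix (K.submatrix (Sum.map ((↑) : {x // x ≠ a₀} → p) id)
          (Sum.map (↑) id))).det := by
  have h := averageTraceSeries_vecMul hsimple hdist hall htriv hB
  have hM : chebyshevMatrix B = (chebyshevMatrix K).submatrix e e := by
    ext1 i j
    simp [chebyshevMatrix, hK, one_apply]
  rw [hM] at h
  have hv : ((fun i => averageTraceSeries G (S i).character) ∘ e.symm) ᵥ* chebyshevMatrix K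
      = Pi.single (Sum.inl a₀) 1 := by
    rw [submatrix_vecMul_equiv] at h
    ext1 x
    simpa [Pi.single_apply, e.symm_apply_eq, he] using congrFun h (e.symm x)
  have hsub : chebyshevMatrix (K.submatrix (Sum.map ((↑) : {x // x ≠ a₀} → p) id) (Sum.map (↑) id))
      = (chebyshevMatrix K).submatrix (Sum.map ((↑) : {x // x ≠ a₀} → p) id) (Sum.map (↑) id) := by
    ext1 i j
    simp [chebyshevMatrix, one_apply, (Subtype.val_injective.sumMap Function.injective_id).eq_iff]
  rw [hsub, ← det_updateRow_single_inl, ← mul_det_of_vecMul_eq_single hv, Function.comp_apply, ← he,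
    e.symm_apply_apply, ← averageTraceSeries_one]
  congr 2
  exact (funext htriv).symm

end McKay

/-- Generalized Ebeling theorem: for a finite subgroup `G` of `SU(2)` with invariant
Poincaré series `P` and McKay matrix `B` (with trivial index `i₀`) admitting a
bipartite block presentation via `D`, `F` and a bijection `e : ι ≃ p ⊕ q` with `e i₀`
in the `p`-component, let `C_a = w₂ w₁` be the affine Coxeter transformation built from
`D, F`, and `C = w₂° w₁°` the Coxeter transformation built from `D°, F°` (the row resp.
column at `e i₀` deleted). Then `P ⬝ det(t² • 1 − C_a) = det(t² • 1 − C)` in `ℂ⟦t⟧`,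
i.e. `P(t) = 𝒳(t²)/𝒳̃(t²)`. -/
theorem generalized_ebeling (G : Subgroup (Matrix.SpecialLinearGroup (Fin 2) ℂ))
    [Fintype G]
    (hG : ∀ g : G, ((g : Matrix.SpecialLinearGroup (Fin 2) ℂ) : Matrix (Fin 2) (Fin 2) ℂ)
      ∈ Matrix.specialUnitaryGroup (Fin 2) ℂ)
    (ι : Type) [Fintype ι] [DecidableEq ι] (ρ : ι → FDRep ℂ G)
    (hsimple : ∀ i, Simple (ρ i))
    (hdist : ∀ i j, i ≠ j → ¬ Nonempty (ρ i ≅ ρ j))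
    (hall : ∀ V : FDRep ℂ G, Simple V → ∃ i, Nonempty (V ≅ ρ i))
    (i₀ : ι) (htriv : ∀ g : G, (ρ i₀).character g = 1)
    (B : Matrix ι ι ℂ)
    (hB : ∀ i j, B i j = (1 / (Fintype.card G : ℂ)) *
      ∑ g : G, (Matrix.trace (((g : Matrix.SpecialLinearGroup (Fin 2) ℂ) :
          Matrix (Fin 2) (Fin 2) ℂ)) * (ρ j).character g) *
        (starRingEnd ℂ) ((ρ i).character g))
    (p q : Type) [Fintype p] [Fintype q] [DecidableEq p] [DecidableEq q]
    (D : Matrix p q ℂ) (F : Matrix q p ℂ) (e : ι ≃ p ⊕ q)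
    (a₀ : p) (he : e i₀ = Sum.inl a₀)
    (hBblocks : ∀ i j, B i j = Matrix.fromBlocks 0 (-(2 • D)) (-(2 • F)) 0 (e i) (e j))
    (Ca : Matrix (p ⊕ q) (p ⊕ q) ℂ)
    (hCa : Ca = Matrix.fromBlocks (-1) (-(2 • D)) 0 1 *
      Matrix.fromBlocks 1 0 (-(2 • F)) (-1))
    (D₀ : Matrix {a : p // a ≠ a₀} q ℂ) (hD₀ : ∀ a j, D₀ a j = D a.1 j)
    (F₀ : Matrix q {a : p // a ≠ a₀} ℂ) (hF₀ : ∀ j a, F₀ j a = F j a.1)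
    (C : Matrix ({a : p // a ≠ a₀} ⊕ q) ({a : p // a ≠ a₀} ⊕ q) ℂ)
    (hC : C = Matrix.fromBlocks (-1) (-(2 • D₀)) 0 1 *
      Matrix.fromBlocks 1 0 (-(2 • F₀)) (-1)) :
    invariantsPoincareSeries G *
        ↑((((Polynomial.X : Polynomial ℂ) ^ 2) • (1 : Matrix (p ⊕ q) (p ⊕ q) (Polynomial ℂ))
            - Ca.map Polynomial.C).det)
      = ↑((((Polynomial.X : Polynomial ℂ) ^ 2) •
              (1 : Matrix ({a : p // a ≠ a₀} ⊕ q) ({a : p // a ≠ a₀} ⊕ q) (Polynomial ℂ))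
            - C.map Polynomial.C).det) := by
  rw [hCa, hC, det_coxeter_eq_det_chebyshevMatrix, det_coxeter_eq_det_chebyshevMatrix,
    invariantsPoincareSeries_mul_det hsimple hdist hall htriv hB e he hBblocks]
  congr 2
  ext (i | i) (j | j) <;> simp [hD₀, hF₀]
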